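/- (Self-nondemolition property.) The output increments commute with each other: [ΔY(i), ΔY(j)] = 0 for all 1 ≤ i, j ≤ N. -/

import Mathlib

open Matrix
open scoped ComplexOrder BigOperators

noncomputable section DiscreteField

/-- Index set of the total Hilbert space `ℂ^d ⊗ (ℂ²)^{⊗N}`. -/
abbrev TIdx (d N : ℕ) := Fin d × (Fin N → Fin 2)

/-- Operators on the total Hilbert space. -/
abbrev TOp (d N : ℕ) := Matrix (TIdx d N) (TIdx d N) ℂ

/-- The lowering operator `σ₋` (entry `(2,1)` equal to `1`). -/
def sigmaMinus : Matrix (Fin 2) (Fin 2) ℂ := !![0, 0; 1, 0]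

/-- The raising operator `σ₊ = σ₋*`. -/
def sigmaPlus : Matrix (Fin 2) (Fin 2) ℂ := star sigmaMinus

/-- The operator acting as the 2×2 matrix `X` on the `l`-th field slice and as the
identity on the system and on all other slices. -/
def sliceOp {d N : ℕ} (l : Fin N) (X : Matrix (Fin 2) (Fin 2) ℂ) : TOp d N :=
  Matrix.of fun p q =>
    if p.1 = q.1 ∧ ∀ i : Fin N, i ≠ l → p.2 i = q.2 i then X (p.2 l) (q.2 l) else 0

/-- The operator acting as the d×d matrix `S` on the system and as the identity on the
field, i.e. `S ⊗ I`. -/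
def sys {d N : ℕ} (S : Matrix (Fin d) (Fin d) ℂ) : TOp d N :=
  Matrix.of fun p q => if p.2 = q.2 then S p.1 q.1 else 0

variable {d N : ℕ}

/-- `ΔA(l) = λ (σ₋)_l`. -/
def dA (lam : ℝ) (l : Fin N) : TOp d N := (lam : ℂ) • sliceOp l sigmaMinus

/-- `ΔΛ(l) = (σ₊σ₋)_l`. -/
def dLam (l : Fin N) : TOp d N := sliceOp l (sigmaPlus * sigmaMinus)

/-- `Δt(l) = λ² I`. -/
def dt (d N : ℕ) (lam : ℝ) : TOp d N := ((lam : ℂ) ^ 2) • 1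

/-- `ΔW(l) = ΔA(l) + ΔA(l)*`. -/
def dW (lam : ℝ) (l : Fin N) : TOp d N := dA lam l + star (dA lam l)

variable (lam : ℝ) (Mpm Mp Mm Mo : Matrix (Fin d) (Fin d) ℂ)

/-- `M_l = I + Mpm ΔΛ(l) + Mp ΔA(l)* + Mm ΔA(l) + Mo Δt(l)`. -/
def Mmat (l : Fin N) : TOp d N :=
  1 + sys Mpm * dLam l + sys Mp * star (dA lam l) + sys Mm * dA lam l + sys Mo * dt d N lam

/-- `U(0) = I`, `U(l) = M_l U(l−1)` (slices are 0-indexed: paper `M_{l+1}` is `Mmat ⟨l,_⟩`). -/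
def Umat : ℕ → TOp d N
  | 0 => 1
  | l + 1 => (if h : l < N then Mmat lam Mpm Mp Mm Mo ⟨l, h⟩ else 1) * Umat l

/-- The flow `j_l(X) = U(l)* X U(l)`. -/
def jmap (l : ℕ) (X : TOp d N) : TOp d N :=
  star (Umat lam Mpm Mp Mm Mo l) * X * Umat lam Mpm Mp Mm Mo l

/-- The output increment `ΔY(l) = U(l)* ΔW(l) U(l)` (for `l : Fin N`, this is the paper's
`ΔY(l+1)`, i.e. paper-time `l+1`). -/
def dY (l : Fin N) : TOp d N :=
  star (Umat lam Mpm Mp Mm Mo (l.1 + 1)) * dW lam l * Umat lam Mpm Mp Mm Mo (l.1 + 1)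

end DiscreteField

section SliceOperators

variable {d N : ℕ}

lemma star_sliceOp (l : Fin N) (X : Matrix (Fin 2) (Fin 2) ℂ) :
    star (sliceOp l X : TOp d N) = sliceOp l (star X) := by
  ext p q
  simp only [sliceOp, Matrix.star_apply, Matrix.of_apply]
  have hsymm : (q.1 = p.1 ∧ ∀ i : Fin N, i ≠ l → q.2 i = p.2 i) ↔
      (p.1 = q.1 ∧ ∀ i : Fin N, i ≠ l → p.2 i = q.2 i) := by
    simp only [eq_comm]
  by_cases h : p.1 = q.1 ∧ ∀ i : Fin N, i ≠ l → p.2 i = q.2 i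
  · rw [if_pos h, if_pos (hsymm.2 h)]
  · rw [if_neg h, if_neg (fun h' => h (hsymm.1 h')), star_zero]

lemma sliceOp_mul_sliceOp_apply {i j : Fin N} (hij : i ≠ j) (X Y : Matrix (Fin 2) (Fin 2) ℂ)
    (p q : TIdx d N) :
    (sliceOp i X * sliceOp j Y : TOp d N) p q =
      if p.1 = q.1 ∧ ∀ k : Fin N, k ≠ i → k ≠ j → p.2 k = q.2 k then
        X (p.2 i) (q.2 i) * Y (p.2 j) (q.2 j) else 0 := by
  rw [Matrix.mul_apply, Fintype.sum_eq_single (p.1, Function.update p.2 i (q.2 i))]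
  · have hleft : ∀ k : Fin N, k ≠ i → p.2 k = Function.update p.2 i (q.2 i) k :=
      fun k hk => by simp [hk]
    have hright : (∀ k : Fin N, k ≠ j → Function.update p.2 i (q.2 i) k = q.2 k) ↔
        ∀ k : Fin N, k ≠ i → k ≠ j → p.2 k = q.2 k := by
      refine forall_congr' fun k => ?_
      by_cases hk : k = i
      · subst hk; simp
      · simp [hk]
    simp only [sliceOp, Matrix.of_apply, hright]
    rw [if_pos ⟨trivial, hleft⟩]
    simp [hij.symm]
  · intro r hr
    simp only [sliceOp, Matrix.of_apply]
    by_contra hne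
    simp only [mul_eq_zero, not_or, ite_eq_right_iff, not_forall] at hne
    obtain ⟨⟨⟨h1, h2⟩, -⟩, ⟨⟨-, h4⟩, -⟩⟩ := hne
    refine hr (Prod.ext h1.symm (funext fun k => ?_))
    rcases eq_or_ne k i with rfl | hk
    · simpa using h4 k hij
    · simpa [hk] using (h2 k hk).symm

lemma sliceOp_commute_sliceOp {i j : Fin N} (hij : i ≠ j) (X Y : Matrix (Fin 2) (Fin 2) ℂ) :
    Commute (sliceOp i X : TOp d N) (sliceOp j Y) := by
  ext p q
  rw [sliceOp_mul_sliceOp_apply hij, sliceOp_mul_sliceOp_apply hij.symm]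
  congr 1
  · exact propext (and_congr_right fun _ => forall_congr' fun _ => forall_comm)
  · exact mul_comm _ _

lemma sys_commute_sliceOp (S : Matrix (Fin d) (Fin d) ℂ) (l : Fin N)
    (X : Matrix (Fin 2) (Fin 2) ℂ) : Commute (sys S : TOp d N) (sliceOp l X) := by
  ext p q
  rw [Matrix.mul_apply, Matrix.mul_apply, Fintype.sum_eq_single (q.1, p.2),
    Fintype.sum_eq_single (p.1, q.2)]
  · simp [sys, sliceOp, mul_comm]
  · intro r hr
    by_contra hne
    simp only [sys, sliceOp, Matrix.of_apply, mul_eq_zero, not_or, ite_eq_right_iff,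
      not_forall] at hne
    obtain ⟨⟨⟨h1, -⟩, -⟩, ⟨h2, -⟩⟩ := hne
    exact hr (Prod.ext h1.symm h2)
  · intro r hr
    by_contra hne
    simp only [sys, sliceOp, Matrix.of_apply, mul_eq_zero, not_or, ite_eq_right_iff,
      not_forall] at hne
    obtain ⟨⟨h1, -⟩, ⟨⟨h2, -⟩, -⟩⟩ := hne
    exact hr (Prod.ext h2 h1.symm)

lemma star_dA (lam : ℝ) (l : Fin N) :
    star (dA lam l : TOp d N) = (lam : ℂ) • sliceOp l (star sigmaMinus) := by
  rw [dA, star_smul, star_sliceOp]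
  simp

lemma commute_dW {A : TOp d N} (lam : ℝ) (l : Fin N)
    (hA : ∀ X : Matrix (Fin 2) (Fin 2) ℂ, Commute A (sliceOp l X)) : Commute A (dW lam l) := by
  rw [dW, star_dA, dA]
  exact ((hA _).smul_right _).add_right ((hA _).smul_right _)

lemma dW_commute_dW (lam : ℝ) {i j : Fin N} (hij : i ≠ j) :
    Commute (dW lam i : TOp d N) (dW lam j) :=
  commute_dW lam j fun X =>
    (commute_dW lam i fun Y => sliceOp_commute_sliceOp hij.symm X Y).symm

lemma Mmat_commute_dW (lam : ℝ) (Mpm Mp Mm Mo : Matrix (Fin d) (Fin d) ℂ) {i l : Fin N}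
    (hil : l ≠ i) : Commute (Mmat lam Mpm Mp Mm Mo l) (dW lam i) := by
  refine commute_dW lam i fun X => ?_
  have hs (Y) : Commute (sliceOp l Y : TOp d N) (sliceOp i X) := sliceOp_commute_sliceOp hil Y X
  have hS (S) : Commute (sys S : TOp d N) (sliceOp i X) := sys_commute_sliceOp S i X
  rw [Mmat, star_dA, dA, dLam, dt]
  exact ((((Commute.one_left _).add_left ((hS _).mul_left (hs _))).add_left
    ((hS _).mul_left ((hs _).smul_left _))).add_left
    ((hS _).mul_left ((hs _).smul_left _))).add_left
    ((hS _).mul_left ((Commute.one_left _).smul_left _))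

end SliceOperators

section Output

variable {d N : ℕ} {lam : ℝ} {Mpm Mp Mm Mo : Matrix (Fin d) (Fin d) ℂ}

lemma Umat_mem_unitaryGroup
    (hU : ∀ l : Fin N, Mmat lam Mpm Mp Mm Mo l ∈ Matrix.unitaryGroup (TIdx d N) ℂ) (k : ℕ) :
    (Umat lam Mpm Mp Mm Mo k : TOp d N) ∈ Matrix.unitaryGroup (TIdx d N) ℂ := by
  induction k with
  | zero => exact one_mem _
  | succ k ih =>
    rw [Umat]
    split_ifs with h
    · exact mul_mem (hU _) ih
    · exact mul_mem (one_mem _) ih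

/-- Slice `i` is not touched after its own interaction, so later flows also produce `ΔY(i)`. -/
lemma jmap_dW_eq_dY
    (hU : ∀ l : Fin N, Mmat lam Mpm Mp Mm Mo l ∈ Matrix.unitaryGroup (TIdx d N) ℂ)
    (i : Fin N) {k : ℕ} (hk : i.1 + 1 ≤ k) :
    jmap lam Mpm Mp Mm Mo k (dW lam i) = dY lam Mpm Mp Mm Mo i := by
  induction k, hk using Nat.le_induction with
  | base => rfl
  | succ k hk ih =>
    rw [← ih, jmap, jmap, Umat]
    split_ifs with h
    · have hne : (⟨k, h⟩ : Fin N) ≠ i := fun e => by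
        have := congrArg Fin.val e
        simp only at this
        omega
      have hconj : star (Mmat lam Mpm Mp Mm Mo ⟨k, h⟩) * dW lam i *
          Mmat lam Mpm Mp Mm Mo ⟨k, h⟩ = dW lam i := by
        rw [mul_assoc, ← (Mmat_commute_dW lam Mpm Mp Mm Mo hne).eq, ← mul_assoc,
          (Unitary.mem_iff.1 (hU _)).1, one_mul]
      rw [star_mul]
      conv_rhs => rw [← hconj]
      simp only [mul_assoc]
    · rw [one_mul]

lemma jmap_mul {k : ℕ}
    (hk : (Umat lam Mpm Mp Mm Mo k : TOp d N) ∈ Matrix.unitaryGroup (TIdx d N) ℂ)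
    (A B : TOp d N) :
    jmap lam Mpm Mp Mm Mo k A * jmap lam Mpm Mp Mm Mo k B =
      jmap lam Mpm Mp Mm Mo k (A * B) := by
  simp only [jmap, mul_assoc]
  rw [← mul_assoc (Umat lam Mpm Mp Mm Mo k) (star _), (Unitary.mem_iff.1 hk).2, one_mul]

end Output

/-- Self-nondemolition property: the output increments commute with each other,
`[ΔY(i), ΔY(j)] = 0` for all `i, j`. -/
theorem output_self_nondemolition {d N : ℕ} (hd : 0 < d) {lam : ℝ}
    (hlam : 0 < lam) (Mpm Mp Mm Mo : Matrix (Fin d) (Fin d) ℂ)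
    (hU : ∀ l : Fin N, Mmat lam Mpm Mp Mm Mo l ∈ Matrix.unitaryGroup (TIdx d N) ℂ)
    (i j : Fin N) :
    dY lam Mpm Mp Mm Mo i * dY lam Mpm Mp Mm Mo j -
      dY lam Mpm Mp Mm Mo j * dY lam Mpm Mp Mm Mo i = 0 := by
  rw [sub_eq_zero]
  rcases eq_or_ne i j with rfl | hij
  · rfl
  have hi := jmap_dW_eq_dY hU i (show i.1 + 1 ≤ max i.1 j.1 + 1 by omega)
  have hj := jmap_dW_eq_dY hU j (show j.1 + 1 ≤ max i.1 j.1 + 1 by omega)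
  rw [← hi, ← hj, jmap_mul (Umat_mem_unitaryGroup hU _), jmap_mul (Umat_mem_unitaryGroup hU _),
    (dW_commute_dW lam hij).eq]
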